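/- arXiv:1701.02119 — 2 statements merged into one kernel-verified Lean document; each statement's English description precedes it below -/
import Mathlib

section
/- Let W: X → Y be a discrete memoryless channel with finite alphabets satisfying |Y| > 2|X|, and let P_X be a fixed input distribution with π(x) > 0 for all x and π(y) > 0 for all y. Then there exist distinct output letters y_a, y_b ∈ Y whose merger yields a channel Q satisfying ΔI = I(W,P_X) − I(Q,P_X) ≤ μ(|X|) · |Y|^{−(|X|+1)/(|X|−1)}, where μ(|X|) := (π|X| / (√(1 + 1/(2(|X|−1))) − 1)²) · (2|X| / Γ(1 + (|X|−1)/2))^{2/(|X|−1)} and Γ is the Gamma function. -/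
open scoped BigOperators

/-- `η(p) = -p ln p` (equals `0` at `p = 0` since `Real.log 0 = 0`). -/
noncomputable def eta (p : ℝ) : ℝ := -p * Real.log p

/-- Output distribution `π(y) = ∑ x, π(x) W(y|x)`. -/
noncomputable def outDist {X Y : Type} [Fintype X] (pX : X → ℝ) (W : X → Y → ℝ) (y : Y) : ℝ :=
  ∑ x, pX x * W x y

/-- Posterior probability `W(x|y) = π(x) W(y|x) / π(y)`. -/
noncomputable def post {X Y : Type} [Fintype X] (pX : X → ℝ) (W : X → Y → ℝ) (x : X) (y : Y) : ℝ :=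
  pX x * W x y / outDist pX W y

/-- Mutual information `I(W, P_X) = ∑ x, η(π(x)) - ∑ x y, π(y) η(W(x|y))`. -/
noncomputable def mutInfo {X Y : Type} [Fintype X] [Fintype Y]
    (pX : X → ℝ) (W : X → Y → ℝ) : ℝ :=
  (∑ x, eta (pX x)) - ∑ x, ∑ y, outDist pX W y * eta (post pX W x y)

/-- The merger of output letters `ya` and `yb`: the new output alphabet is
`Option {y // y ≠ ya ∧ y ≠ yb}`, with `none` playing the role of the merged letter `y_ab`. -/
noncomputable def merger {X Y : Type} [DecidableEq Y] (W : X → Y → ℝ) (ya yb : Y) (x : X) :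
    Option {y : Y // y ≠ ya ∧ y ≠ yb} → ℝ
  | none => W x ya + W x yb
  | some y => W x y.1


lemma aux_log (α γ : ℝ) (hα : 0 ≤ α) (hγ : 0 < γ) :
    α * Real.log α - α * Real.log γ ≤ α * (α / γ - 1) := by
  rcases hα.eq_or_lt with h | h
  · simp [← h]
  · rw [← mul_sub, ← Real.log_div h.ne' hγ.ne']
    exact mul_le_mul_of_nonneg_left (Real.log_le_sub_one_of_pos (by positivity)) hα

lemma aux_alg (p r a b : ℝ) (hp : 0 < p) (hr : 0 < r) (hD : 0 < p * a ^ 2 + r * b ^ 2) :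
    p * (a ^ 2 * (a ^ 2 / ((p * a ^ 2 + r * b ^ 2) / (p + r)) - 1)) +
      r * (b ^ 2 * (b ^ 2 / ((p * a ^ 2 + r * b ^ 2) / (p + r)) - 1)) ≤
      (p + r) * (a - b) ^ 2 := by
  have e : p * (a ^ 2 * (a ^ 2 / ((p * a ^ 2 + r * b ^ 2) / (p + r)) - 1)) +
      r * (b ^ 2 * (b ^ 2 / ((p * a ^ 2 + r * b ^ 2) / (p + r)) - 1)) =
      p * r * (a - b) ^ 2 * (a + b) ^ 2 / (p * a ^ 2 + r * b ^ 2) := by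
    have : p + r ≠ 0 := by positivity
    field_simp
    ring
  rw [e, div_le_iff₀ hD]
  nlinarith [mul_nonneg (sq_nonneg (a - b)) (sq_nonneg (p * a - r * b))]

lemma aux_key (p r α β : ℝ) (hp : 0 < p) (hr : 0 < r) (hα : 0 ≤ α) (hβ : 0 ≤ β) :
    (p + r) * eta ((p * α + r * β) / (p + r)) - p * eta α - r * eta β ≤
      (p + r) * (Real.sqrt α - Real.sqrt β) ^ 2 := by
  have hD : 0 ≤ p * α + r * β := by positivity
  rcases hD.eq_or_lt with h | h
  · have h1 : p * α = 0 := by nlinarith [mul_nonneg hp.le hα, mul_nonneg hr.le hβ]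
    have h2 : r * β = 0 := by nlinarith [mul_nonneg hp.le hα, mul_nonneg hr.le hβ]
    have h1 : α = 0 := by simpa [hp.ne'] using h1
    have h2 : β = 0 := by simpa [hr.ne'] using h2
    simp [h1, h2, eta]
  · set γ := (p * α + r * β) / (p + r) with hγ
    have hγ0 : 0 < γ := by positivity
    have hg : (p + r) * γ = p * α + r * β := by rw [hγ]; field_simp
    have a1 := mul_le_mul_of_nonneg_left (aux_log α γ hα hγ0) hp.le
    have a2 := mul_le_mul_of_nonneg_left (aux_log β γ hβ hγ0) hr.le
    have a3 := aux_alg p r (Real.sqrt α) (Real.sqrt β) hp hr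
      (by rwa [Real.sq_sqrt hα, Real.sq_sqrt hβ])
    rw [Real.sq_sqrt hα, Real.sq_sqrt hβ, ← hγ] at a3
    have e : (p + r) * eta γ = -(p * α + r * β) * Real.log γ := by
      rw [← hg]; unfold eta; ring
    rw [e]
    unfold eta
    nlinarith

lemma aux_rad {X : Type} [Fintype X] (a b : X → ℝ) (s t : ℝ) (ha : ∑ x, a x ^ 2 = 1)
    (hb : ∑ x, b x ^ 2 = 1) (hs : 1 ≤ s) (ht : 1 ≤ t) :
    ∑ x, (a x - b x) ^ 2 ≤ ∑ x, (s * a x - t * b x) ^ 2 := by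
  have e : ∀ s t : ℝ, ∑ x, (s * a x - t * b x) ^ 2 =
      s ^ 2 + t ^ 2 - 2 * s * t * ∑ x, a x * b x := by
    intro s t
    calc _ = ∑ x, (s ^ 2 * a x ^ 2 + t ^ 2 * b x ^ 2 - 2 * s * t * (a x * b x)) :=
          Finset.sum_congr rfl fun x _ => by ring
      _ = _ := by
          rw [Finset.sum_sub_distrib, Finset.sum_add_distrib, ← Finset.mul_sum,
            ← Finset.mul_sum, ← Finset.mul_sum, ha, hb]; ring
  have e1 := e 1 1
  simp only [one_mul] at e1
  have h0 : 0 ≤ ∑ x, (a x - b x) ^ 2 := Finset.sum_nonneg fun x _ => sq_nonneg _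
  rw [e1] at h0 ⊢
  rw [e]
  set c := ∑ x, a x * b x
  have hc : c ≤ 1 := by linarith
  have hst : 1 ≤ s * t := by nlinarith
  nlinarith [mul_nonneg (sub_nonneg.2 hc) (sub_nonneg.2 hst), sq_nonneg (s - t)]

lemma aux_cell (k : ℕ) (hk : 1 ≤ k) (w : ℝ) (h0 : 0 ≤ w) (h1 : w ≤ 1) :
    ∃ c : Fin k, (c : ℝ) ≤ w * k ∧ w * k ≤ (c : ℝ) + 1 := by
  have hk' : (1 : ℝ) ≤ k := by exact_mod_cast hk
  by_cases h : w * k < k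
  · refine ⟨⟨⌊w * k⌋₊, (Nat.floor_lt (by positivity)).2 h⟩, Nat.floor_le (by positivity),
      (Nat.lt_floor_add_one _).le⟩
  · refine ⟨⟨k - 1, by omega⟩, ?_, ?_⟩
    · simp only [Nat.cast_sub hk]; push_cast; linarith
    · simp only [Nat.cast_sub hk]; push_cast; nlinarith

lemma aux_pack {X Y : Type} [Fintype X] [Nonempty X] (S : Finset Y)
    (u : Y → X → ℝ) (hu0 : ∀ y x, 0 ≤ u y x) (hu1 : ∀ y, ∑ x, u y x ^ 2 = 1)
    (k : ℕ) (hk : 1 ≤ k) (hS : Fintype.card X * k ^ (Fintype.card X - 1) < S.card) :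
    ∃ a ∈ S, ∃ b ∈ S, a ≠ b ∧
      ∑ x, (u a x - u b x) ^ 2 ≤ ((Fintype.card X : ℝ) - 1) / (k : ℝ) ^ 2 := by
  classical
  have hk' : (1 : ℝ) ≤ k := by exact_mod_cast hk
  have hmax : ∀ y, ∃ i, ∀ j, u y j ≤ u y i := fun y => by
    obtain ⟨i, hi⟩ := Finite.exists_max (u y)
    exact ⟨i, hi⟩
  choose m hm using hmax
  have hpos : ∀ y, 0 < u y (m y) := by
    intro y
    by_contra hn
    have : ∀ x, u y x = 0 := fun x => le_antisymm ((hm y x).trans (not_lt.1 hn)) (hu0 y x)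
    have h := hu1 y
    simp [this] at h
  have hle : ∀ y, u y (m y) ≤ 1 := by
    intro y
    have h := Finset.single_le_sum (f := fun x => u y x ^ 2) (fun x _ => sq_nonneg _)
      (Finset.mem_univ (m y))
    simp only [hu1 y] at h
    nlinarith [hpos y]
  have hcell : ∀ y x, ∃ c : Fin k, (c : ℝ) ≤ (u y (m y))⁻¹ * u y x * k ∧
      (u y (m y))⁻¹ * u y x * k ≤ (c : ℝ) + 1 := by
    intro y x
    apply aux_cell k hk
    · exact mul_nonneg (inv_nonneg.2 (hpos y).le) (hu0 y x)
    · rw [inv_mul_le_iff₀ (hpos y), mul_one]; exact hm y x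
  choose c hc1 hc2 using hcell
  let f : Y → (Σ i : X, ({j : X // j ≠ i} → Fin k)) := fun y => ⟨m y, fun j => c y j⟩
  have hcardT : Fintype.card (Σ i : X, ({j : X // j ≠ i} → Fin k)) =
      Fintype.card X * k ^ (Fintype.card X - 1) := by
    simp [Fintype.card_sigma, Fintype.card_subtype_compl]
  obtain ⟨a, ha, b, hb, hab, hf⟩ := Finset.exists_ne_map_eq_of_card_lt_of_maps_to
    (s := S) (t := Finset.univ) (f := f) (by rw [Finset.card_univ, hcardT]; exact hS)
    (fun _ _ => Finset.mem_coe.2 (Finset.mem_univ _))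
  refine ⟨a, ha, b, hb, hab, ?_⟩
  have hmab : m a = m b := congrArg Sigma.fst hf
  have hcab : ∀ x, x ≠ m a → c a x = c b x := by
    intro x hx
    have key : ∀ (p q : Σ i : X, ({j : X // j ≠ i} → Fin k)), p = q →
        ∀ (h1 : x ≠ p.1) (h2 : x ≠ q.1), p.2 ⟨x, h1⟩ = q.2 ⟨x, h2⟩ := by
      rintro p q rfl h1 h2; rfl
    exact key _ _ hf hx (by simpa [f, ← hmab] using hx)
  refine (aux_rad (u a) (u b) (u a (m a))⁻¹ (u b (m b))⁻¹ (hu1 a) (hu1 b)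
    ((one_le_inv₀ (hpos a)).2 (hle a)) ((one_le_inv₀ (hpos b)).2 (hle b))).trans ?_
  rw [← Finset.add_sum_erase _ _ (Finset.mem_univ (m a))]
  have z : (u a (m a))⁻¹ * u a (m a) - (u b (m b))⁻¹ * u b (m a) = 0 := by
    rw [inv_mul_cancel₀ (hpos a).ne', hmab, inv_mul_cancel₀ (hpos b).ne', sub_self]
  rw [z]
  have hb : ∀ x ∈ Finset.univ.erase (m a),
      ((u a (m a))⁻¹ * u a x - (u b (m b))⁻¹ * u b x) ^ 2 ≤ 1 / (k : ℝ) ^ 2 := by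
    intro x hx
    have e := hcab x (Finset.ne_of_mem_erase hx)
    have h1 := hc1 a x
    have h2 := hc2 a x
    have h3 := hc1 b x
    have h4 := hc2 b x
    rw [e] at h1 h2
    rw [le_div_iff₀ (by positivity), ← mul_pow, sub_mul]
    rw [sq_le_one_iff_abs_le_one, abs_le]
    constructor <;> linarith
  have := Finset.sum_le_card_nsmul _ _ _ hb
  rw [Finset.card_erase_of_mem (Finset.mem_univ _), Finset.card_univ, nsmul_eq_mul,
    Nat.cast_sub Fintype.card_pos] at this
  refine le_trans ?_ (this.trans (le_of_eq ?_))
  · simp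
  · push_cast; ring

lemma aux_gamma (d : ℕ) : Real.Gamma (1 + (d : ℝ) / 2) ≤ ((d : ℝ) + 1) ^ ((d : ℝ) / 2) := by
  induction d using Nat.twoStepInduction with
  | zero => simp
  | one =>
    have : Real.Gamma (1 + ((1 : ℕ) : ℝ) / 2) = 1 / 2 * Real.sqrt Real.pi := by
      rw [add_comm, Real.Gamma_add_one (by norm_num)]
      push_cast
      rw [Real.Gamma_one_half_eq]
    rw [this]
    have h1 : Real.sqrt Real.pi ≤ 2 := by
      rw [Real.sqrt_le_left (by norm_num)]; nlinarith [Real.pi_le_four]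
    have h2 : (1 : ℝ) ≤ (((1 : ℕ) : ℝ) + 1) ^ (((1 : ℕ) : ℝ) / 2) :=
      Real.one_le_rpow (by norm_num) (by norm_num)
    linarith
  | more n ih _ =>
    have e : Real.Gamma (1 + ((n + 2 : ℕ) : ℝ) / 2) =
        (1 + (n : ℝ) / 2) * Real.Gamma (1 + (n : ℝ) / 2) := by
      rw [← Real.Gamma_add_one (by positivity)]
      congr 1; push_cast; ring
    rw [e]
    have e2 : (((n + 2 : ℕ) : ℝ) + 1) ^ (((n + 2 : ℕ) : ℝ) / 2) =
        ((n : ℝ) + 3) * ((n : ℝ) + 3) ^ ((n : ℝ) / 2) := by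
      have : (((n + 2 : ℕ) : ℝ)) / 2 = 1 + (n : ℝ) / 2 := by push_cast; ring
      rw [this, Real.rpow_add (by positivity), Real.rpow_one]
      push_cast; ring_nf
    rw [e2]
    apply mul_le_mul
    · have : (0 : ℝ) ≤ n := by positivity
      linarith
    · refine ih.trans (Real.rpow_le_rpow (by positivity) (by linarith) (by positivity))
    · exact (Real.Gamma_pos_of_pos (by positivity)).le
    · positivity

lemma aux_num (d n : ℝ) (hd : 1 ≤ d) (hn : 0 < n) (G : ℝ) (hG0 : 0 < G)
    (hG : G ≤ (d + 1) ^ (d / 2)) (k : ℝ) (hk0 : 0 < k)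
    (hk : (n / (2 * (d + 1))) ^ (1 / d) ≤ 2 * k) :
    (4 / n) * (d / k ^ 2) ≤
      (Real.pi * (d + 1) / (Real.sqrt (1 + 1 / (2 * d)) - 1) ^ 2 *
        (2 * (d + 1) / G) ^ (2 / d)) * n ^ (-((d + 1 + 1) / d)) := by
  have hd0 : 0 < d := by linarith
  set s := Real.sqrt (1 + 1 / (2 * d)) - 1 with hs
  have hs0 : 0 < s := by
    rw [hs, sub_pos]
    apply Real.lt_sqrt_of_sq_lt
    have : 0 < 1 / (2 * d) := by positivity
    linarith
  have hs1 : s ≤ 1 / (4 * d) := by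
    rw [hs, sub_le_iff_le_add, Real.sqrt_le_left (by positivity)]
    have : (1 / (4 * d) + 1) ^ 2 = 1 + 1 / (2 * d) + (1 / (4 * d)) ^ 2 := by
      field_simp; ring
    rw [this]; nlinarith [sq_nonneg (1 / (4 * d))]
  have hs2 : 16 * d ^ 2 ≤ 1 / s ^ 2 := by
    rw [le_div_iff₀ (by positivity)]
    have h : s * (4 * d) ≤ 1 := by rwa [le_div_iff₀ (by positivity)] at hs1
    have h0 : 0 ≤ s * (4 * d) := by positivity
    nlinarith
  have hGd : G ^ (2 / d) ≤ d + 1 := by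
    calc G ^ (2 / d) ≤ ((d + 1) ^ (d / 2)) ^ (2 / d) :=
          Real.rpow_le_rpow hG0.le hG (by positivity)
      _ = d + 1 := by
          rw [← Real.rpow_mul (by positivity)]
          rw [show d / 2 * (2 / d) = 1 by field_simp, Real.rpow_one]
  set T := (2 * (d + 1)) ^ (2 / d) with hT
  set N := n ^ (2 / d) with hN
  have hT0 : 0 < T := by positivity
  have hN0 : 0 < N := by positivity
  have hGp : 0 < G ^ (2 / d) := by positivity
  have hk2 : N / T ≤ 4 * k ^ 2 := by
    have := pow_le_pow_left₀ (by positivity) hk 2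
    rw [← Real.rpow_natCast, ← Real.rpow_mul (by positivity),
      show 1 / d * ((2 : ℕ) : ℝ) = 2 / d by push_cast; ring,
      Real.div_rpow hn.le (by positivity)] at this
    calc N / T ≤ _ := this
      _ = _ := by ring
  have e1 : n ^ (-((d + 1 + 1) / d)) = 1 / (n * N) := by
    rw [Real.rpow_neg hn.le, show (d + 1 + 1) / d = 1 + 2 / d by field_simp; ring,
      Real.rpow_add hn, Real.rpow_one, one_div]
  rw [e1, Real.div_rpow (by positivity) hG0.le]
  have hpi : 1 ≤ Real.pi := by linarith [Real.pi_gt_three]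
  have hkk : 1 / k ^ 2 ≤ 4 * T / N := by
    rw [div_le_div_iff₀ (by positivity) hN0]
    rw [div_le_iff₀ hT0] at hk2
    linarith
  have hGT : T / (d + 1) ≤ T / G ^ (2 / d) := div_le_div_of_nonneg_left hT0.le hGp hGd
  calc 4 / n * (d / k ^ 2) = 4 * d / n * (1 / k ^ 2) := by ring
    _ ≤ 4 * d / n * (4 * T / N) := mul_le_mul_of_nonneg_left hkk (by positivity)
    _ = (16 * d) * T * (1 / (n * N)) := by field_simp; ring
    _ ≤ (Real.pi * (d + 1) * (1 / s ^ 2) * (T / G ^ (2 / d))) * (1 / (n * N)) := by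
        apply mul_le_mul_of_nonneg_right _ (by positivity)
        calc 16 * d * T ≤ 1 * (d + 1) * (16 * d ^ 2) * (T / (d + 1)) := by
              have : 1 * (d + 1) * (16 * d ^ 2) * (T / (d + 1)) = 16 * d * T * d := by
                field_simp
              rw [this]
              exact le_mul_of_one_le_right (by positivity) hd
          _ ≤ _ := by gcongr
    _ = _ := by ring

lemma aux_delta {X Y : Type} [Fintype X] [Fintype Y] [DecidableEq Y]
    (pX : X → ℝ) (W : X → Y → ℝ) (hW0 : ∀ x y, 0 ≤ W x y) (hpX : ∀ x, 0 < pX x)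
    (hpY : ∀ y, 0 < outDist pX W y) (a b : Y) (hab : a ≠ b) :
    mutInfo pX W - mutInfo pX (merger W a b) ≤ (outDist pX W a + outDist pX W b) *
      ∑ x, (Real.sqrt (post pX W x a) - Real.sqrt (post pX W x b)) ^ 2 := by
  have o1 : outDist pX (merger W a b) none = outDist pX W a + outDist pX W b := by
    simp [outDist, merger, mul_add, Finset.sum_add_distrib]
  have o2 : ∀ y : {y : Y // y ≠ a ∧ y ≠ b},
      outDist pX (merger W a b) (some y) = outDist pX W y.1 := fun y => rfl
  have p2 : ∀ x, ∀ y : {y : Y // y ≠ a ∧ y ≠ b},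
      post pX (merger W a b) x (some y) = post pX W x y.1 := fun x y => rfl
  have p0 : ∀ x y, 0 ≤ post pX W x y := fun x y =>
    div_nonneg (mul_nonneg (hpX x).le (hW0 x y)) (hpY y).le
  have pm : ∀ x y, outDist pX W y * post pX W x y = pX x * W x y := fun x y => by
    unfold post; rw [mul_div_cancel₀ _ (hpY y).ne']
  have p1 : ∀ x, post pX (merger W a b) x none =
      (outDist pX W a * post pX W x a + outDist pX W b * post pX W x b) /
        (outDist pX W a + outDist pX W b) := by
    intro x
    rw [pm, pm, ← o1]; simp only [post, merger]; rw [mul_add]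
  unfold mutInfo
  rw [sub_sub_sub_cancel_left, ← Finset.sum_sub_distrib, Finset.mul_sum]
  apply Finset.sum_le_sum
  intro x _
  have key := aux_key _ _ _ _ (hpY a) (hpY b) (p0 x a) (p0 x b)
  refine le_trans (le_of_eq ?_) key
  rw [Fintype.sum_option, o1, p1]
  simp only [o2, p2]
  have e1 : ∑ y : {y : Y // y ≠ a ∧ y ≠ b}, outDist pX W y.1 * eta (post pX W x y.1) =
      ∑ y ∈ (Finset.univ.erase a).erase b, outDist pX W y * eta (post pX W x y) := by
    symm
    apply Finset.sum_subtype
    intro y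
    simp [and_comm]
  rw [e1, ← Finset.add_sum_erase _ _ (Finset.mem_univ a),
    ← Finset.add_sum_erase (Finset.univ.erase a) _
      (Finset.mem_erase.2 ⟨hab.symm, Finset.mem_univ b⟩)]
  ring

/-- **Theorem 1 (greedy-merge single step).** If `|Y| > 2|X|` then there is a pair of distinct
output letters whose merger `Q` satisfies
`ΔI = I(W,P_X) - I(Q,P_X) ≤ μ(|X|) ⬝ |Y| ^ (-(|X|+1)/(|X|-1))`. -/
theorem exists_merger_deltaI_le {X Y : Type} [Fintype X] [Fintype Y] [DecidableEq Y]
    (pX : X → ℝ) (W : X → Y → ℝ)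
    (hW0 : ∀ x y, 0 ≤ W x y) (hW1 : ∀ x, ∑ y, W x y = 1)
    (hpX : ∀ x, 0 < pX x) (hpXsum : ∑ x, pX x = 1)
    (hpY : ∀ y, 0 < outDist pX W y)
    (hcard : 2 * Fintype.card X < Fintype.card Y) :
    ∃ ya yb : Y, ya ≠ yb ∧
      mutInfo pX W - mutInfo pX (merger W ya yb) ≤
        (Real.pi * (Fintype.card X : ℝ) /
            (Real.sqrt (1 + 1 / (2 * ((Fintype.card X : ℝ) - 1))) - 1) ^ 2 *
          (2 * (Fintype.card X : ℝ) /
              Real.Gamma (1 + ((Fintype.card X : ℝ) - 1) / 2)) ^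
            (2 / ((Fintype.card X : ℝ) - 1))) *
        (Fintype.card Y : ℝ) ^
          (-(((Fintype.card X : ℝ) + 1) / ((Fintype.card X : ℝ) - 1))) := by
  classical
  have hX : Nonempty X := by
    by_contra h
    rw [not_nonempty_iff] at h
    simp at hpXsum
  have hY1 : ∑ y, outDist pX W y = 1 := by
    unfold outDist
    rw [Finset.sum_comm]
    simp only [← Finset.mul_sum, hW1, mul_one, hpXsum]
  have hq : 1 ≤ Fintype.card X := Fintype.card_pos
  have hpost1 : ∀ y, ∑ x, post pX W x y = 1 := by
    intro y
    unfold post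
    rw [← Finset.sum_div]
    exact div_self (hpY y).ne'
  have hpost0 : ∀ x y, 0 ≤ post pX W x y := fun x y =>
    div_nonneg (mul_nonneg (hpX x).le (hW0 x y)) (hpY y).le
  rcases hq.eq_or_lt with hq1 | hq2
  · -- a single input letter: no information is lost
    obtain ⟨a, b, hab⟩ := Fintype.exists_pair_of_one_lt_card (α := Y) (by omega)
    refine ⟨a, b, hab, (aux_delta pX W hW0 hpX hpY a b hab).trans ?_⟩
    obtain ⟨x0, hx0⟩ := Fintype.card_eq_one_iff.1 hq1.symm
    have hu : (Finset.univ : Finset X) = {x0} := by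
      ext x; simp [hx0 x]
    have h1 : ∀ y, post pX W x0 y = 1 := by
      intro y
      have := hpost1 y
      rwa [hu, Finset.sum_singleton] at this
    rw [← hq1, hu, Finset.sum_singleton, h1, h1]
    simp
  · set q := Fintype.card X with hqdef
    set n := Fintype.card Y with hndef
    have hn0 : (0 : ℝ) < n := by
      have : 0 < n := by omega
      exact_mod_cast this
    have hcardR : 2 * (q : ℝ) < n := by exact_mod_cast hcard
    have hq2R : (2 : ℝ) ≤ q := by exact_mod_cast hq2
    -- the light letters
    let S : Finset Y := Finset.univ.filter fun y => outDist pX W y ≤ 2 / n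
    have hScard : (n : ℝ) / 2 ≤ S.card := by
      let S' : Finset Y := Finset.univ.filter fun y => ¬ outDist pX W y ≤ 2 / n
      have h1 : S.card + S'.card = n := by
        exact (Finset.card_filter_add_card_filter_not
          (s := (Finset.univ : Finset Y)) (fun y => outDist pX W y ≤ 2 / n)).trans
          Finset.card_univ
      have h2 : S'.card • (2 / (n : ℝ)) ≤ ∑ y ∈ S', outDist pX W y :=
        Finset.card_nsmul_le_sum _ _ _ fun y hy => (not_le.1 (Finset.mem_filter.1 hy).2).le
      have h3 : ∑ y ∈ S', outDist pX W y ≤ 1 := by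
        rw [← hY1]
        exact Finset.sum_le_sum_of_subset_of_nonneg (Finset.subset_univ _)
          fun y _ _ => (hpY y).le
      have h4 := h2.trans h3
      rw [nsmul_eq_mul, mul_div_assoc', div_le_one hn0] at h4
      have h5 : (S.card : ℝ) + S'.card = n := by exact_mod_cast h1
      linarith
    set t : ℝ := ((n : ℝ) / (2 * q)) ^ (1 / ((q : ℝ) - 1)) with ht
    have ht1 : 1 < t := Real.one_lt_rpow
      (by rw [lt_div_iff₀ (by linarith)]; linarith) (one_div_pos.2 (by linarith))
    obtain ⟨k, hk⟩ : ∃ k : ℕ, ⌈t⌉₊ = k + 1 :=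
      Nat.exists_eq_succ_of_ne_zero (by
        have := Nat.ceil_pos.2 (zero_lt_one.trans ht1); omega)
    have hkt : (k : ℝ) < t := Nat.lt_ceil.1 (by omega)
    have htk : t ≤ (k : ℝ) + 1 := by
      have := Nat.le_ceil t
      rw [hk] at this; exact_mod_cast this
    have hk1 : 1 ≤ k := by
      have : (0 : ℝ) < k := by linarith
      exact_mod_cast this
    have hk1R : (1 : ℝ) ≤ k := by exact_mod_cast hk1
    have htpow : t ^ (q - 1) = (n : ℝ) / (2 * q) := by
      rw [ht, ← Real.rpow_natCast, ← Real.rpow_mul (by positivity), Nat.cast_sub hq]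
      have : (q : ℝ) - 1 ≠ 0 := by linarith
      push_cast
      rw [one_div_mul_cancel this, Real.rpow_one]
    have hcount : q * k ^ (q - 1) < S.card := by
      have h1 : (k : ℝ) ^ (q - 1) < (n : ℝ) / (2 * q) := by
        rw [← htpow]
        exact pow_lt_pow_left₀ hkt (by positivity) (by omega)
      have h2 : (q : ℝ) * (k : ℝ) ^ (q - 1) < S.card := by
        rw [lt_div_iff₀ (by positivity)] at h1
        linarith
      exact_mod_cast h2
    obtain ⟨a, ha, b, hb, hab, hdist⟩ := aux_pack S (fun y x => Real.sqrt (post pX W x y))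
      (fun y x => Real.sqrt_nonneg _)
      (fun y => by simp only [Real.sq_sqrt (hpost0 _ _), hpost1]) k hk1 hcount
    refine ⟨a, b, hab, (aux_delta pX W hW0 hpX hpY a b hab).trans ?_⟩
    have ha' : outDist pX W a ≤ 2 / n := (Finset.mem_filter.1 ha).2
    have hb' : outDist pX W b ≤ 2 / n := (Finset.mem_filter.1 hb).2
    have hsum : outDist pX W a + outDist pX W b ≤ 4 / n := by
      calc _ ≤ 2 / (n : ℝ) + 2 / n := add_le_add ha' hb'
        _ = _ := by ring
    have hG := aux_gamma (q - 1)
    rw [Nat.cast_sub hq, Nat.cast_one] at hG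
    have num := aux_num ((q : ℝ) - 1) n (by linarith) hn0
      (Real.Gamma (1 + ((q : ℝ) - 1) / 2))
      (Real.Gamma_pos_of_pos (by linarith)) hG k (by linarith)
      (by rw [sub_add_cancel]; linarith)
    rw [sub_add_cancel] at num
    refine le_trans ?_ num
    exact mul_le_mul hsum hdist (Finset.sum_nonneg fun x _ => sq_nonneg _) (by positivity)
end

section
/- Let W: X → Y be a discrete memoryless channel with finite alphabets satisfying |Y| > 2|X|, let P_X be a fixed input distribution with π(x) > 0 for all x and π(y) > 0 for all y, and let L be an integer with L ≥ 2|X|. Then the optimal degrading loss satisfies ΔI*(W,P_X,L) ≤ ν(|X|) · L^{−2/(|X|−1)}, where ν(|X|) := ((|X|−1)/2) · μ(|X|) and μ(|X|) := (π|X| / (√(1 + 1/(2(|X|−1))) − 1)²) · (2|X| / Γ(1 + (|X|−1)/2))^{2/(|X|−1)}. -/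
open scoped BigOperators

/-- `Q : X → Z` is (stochastically) degraded with respect to `W : X → Y`: there is an
intermediate channel `Φ : Y → Z` with `Q(z|x) = ∑ y, W(y|x) Φ(z|y)`. -/
def IsDegraded {X Y Z : Type} [Fintype Y] [Fintype Z]
    (W : X → Y → ℝ) (Q : X → Z → ℝ) : Prop :=
  ∃ Φ : Y → Z → ℝ, (∀ y z, 0 ≤ Φ y z) ∧ (∀ y, ∑ z, Φ y z = 1) ∧
    ∀ x z, Q x z = ∑ y, W x y * Φ y z

lemma jensen_gap {Y : Type} (s : Finset Y) (w p : Y → ℝ) (hw : ∀ y ∈ s, 0 < w y)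
    (hp : ∀ y ∈ s, 0 ≤ p y) (S c : ℝ) (hS : S = ∑ y ∈ s, w y) (hc0 : 0 ≤ c)
    (hc : S * c = ∑ y ∈ s, w y * p y) :
    S * eta c - ∑ y ∈ s, w y * eta (p y) ≤ (∑ y ∈ s, w y * (p y - c) ^ 2) / c := by
  rcases hc0.eq_or_lt with h | h
  · subst h
    have h1 : ∀ y ∈ s, w y * p y = 0 := by
      rw [mul_zero] at hc
      exact (Finset.sum_eq_zero_iff_of_nonneg
        (fun y hy => mul_nonneg (hw y hy).le (hp y hy))).1 hc.symm
    have h2 : ∑ y ∈ s, w y * eta (p y) = 0 := by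
      apply Finset.sum_eq_zero
      intro y hy
      have := (mul_eq_zero.1 (h1 y hy)).resolve_left (hw y hy).ne'
      simp [eta, this]
    rw [h2]
    simp [eta]
  · have e1 : S * eta c - ∑ y ∈ s, w y * eta (p y)
        = ∑ y ∈ s, w y * (p y * (Real.log (p y) - Real.log c)) := by
      have : S * eta c = -(∑ y ∈ s, w y * p y * Real.log c) := by
        rw [← Finset.sum_mul, ← hc]; simp only [eta]; ring
      rw [this, ← Finset.sum_neg_distrib, ← Finset.sum_sub_distrib]
      apply Finset.sum_congr rfl
      intro y _
      simp only [eta]; ring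
    have e2 : (∑ y ∈ s, w y * (p y - c) ^ 2) / c = ∑ y ∈ s, w y * (p y * (p y / c - 1)) := by
      have e3 : ∑ y ∈ s, w y * (p y - c) = 0 := by
        simp only [mul_sub, Finset.sum_sub_distrib, ← Finset.sum_mul, ← hc, ← hS]
        ring
      rw [Finset.sum_div, ← add_zero (∑ y ∈ s, w y * (p y - c) ^ 2 / c), ← e3,
        ← Finset.sum_add_distrib]
      apply Finset.sum_congr rfl
      intro y _
      field_simp
      ring
    rw [e1, e2]
    apply Finset.sum_le_sum
    intro y hy
    apply mul_le_mul_of_nonneg_left _ (hw y hy).le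
    rcases (hp y hy).eq_or_lt with h0 | h0
    · simp [← h0]
    · apply mul_le_mul_of_nonneg_left _ h0.le
      rw [← Real.log_div h0.ne' h.ne']
      exact Real.log_le_sub_one_of_pos (by positivity)

lemma var_bound {Y : Type} (s : Finset Y) (w p : Y → ℝ) (hw : ∀ y ∈ s, 0 < w y)
    (hp : ∀ y ∈ s, 0 ≤ p y) (S c : ℝ) (hS : S = ∑ y ∈ s, w y) (hSpos : 0 < S)
    (hc : S * c = ∑ y ∈ s, w y * p y) (M : ℝ) (hM : 0 < M) (i : ℕ)
    (h1 : ∀ y ∈ s, (i : ℝ) ^ 2 ≤ M * p y) (h2 : ∀ y ∈ s, M * p y ≤ ((i : ℝ) + 1) ^ 2) :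
    ∑ y ∈ s, w y * (p y - c) ^ 2 ≤ 9 * S * c / M := by
  rw [le_div_iff₀ hM]
  have hc0 : 0 ≤ c := by
    have : 0 ≤ S * c := hc ▸ Finset.sum_nonneg (fun y hy => mul_nonneg (hw y hy).le (hp y hy))
    exact nonneg_of_mul_nonneg_right this hSpos
  have hl : (i : ℝ) ^ 2 ≤ M * c := by
    have : S * (i : ℝ) ^ 2 ≤ S * (M * c) := by
      rw [show S * (M * c) = M * (S * c) by ring, hc, hS, Finset.sum_mul, Finset.mul_sum]
      apply Finset.sum_le_sum
      intro y hy
      nlinarith [hw y hy, h1 y hy]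
    exact le_of_mul_le_mul_left this hSpos
  have hu : M * c ≤ ((i : ℝ) + 1) ^ 2 := by
    have : S * (M * c) ≤ S * ((i : ℝ) + 1) ^ 2 := by
      rw [show S * (M * c) = M * (S * c) by ring, hc, hS, Finset.sum_mul, Finset.mul_sum]
      apply Finset.sum_le_sum
      intro y hy
      nlinarith [hw y hy, h2 y hy]
    exact le_of_mul_le_mul_left this hSpos
  rcases Nat.eq_zero_or_pos i with h | h
  · subst h
    have e : ∑ y ∈ s, w y * (p y - c) ^ 2 = ∑ y ∈ s, w y * p y ^ 2 - S * c ^ 2 := by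
      have e3 : ∑ y ∈ s, w y * (p y - c) = 0 := by
        simp only [mul_sub, Finset.sum_sub_distrib, ← Finset.sum_mul, ← hc, ← hS]
        ring
      have e4 : ∑ y ∈ s, w y * (p y - c) ^ 2
          = ∑ y ∈ s, w y * p y ^ 2 - S * c ^ 2 - 2 * c * ∑ y ∈ s, w y * (p y - c) := by
        rw [hS, Finset.sum_mul, Finset.mul_sum, ← Finset.sum_sub_distrib,
          ← Finset.sum_sub_distrib]
        apply Finset.sum_congr rfl
        intro y _
        ring
      rw [e4, e3]; ring
    have e5 : (∑ y ∈ s, w y * p y ^ 2) * M ≤ S * c := by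
      rw [hc, Finset.sum_mul]
      apply Finset.sum_le_sum
      intro y hy
      have := h2 y hy
      simp only [Nat.cast_zero, zero_add, one_pow] at this
      nlinarith [mul_nonneg (hw y hy).le (hp y hy)]
    rw [e]
    have : 0 ≤ S * c := by positivity
    have : 0 ≤ S * c ^ 2 * M := by positivity
    nlinarith
  · have hi : (1 : ℝ) ≤ i := by exact_mod_cast h
    have key : ∀ y ∈ s, (p y - c) ^ 2 * M ≤ 9 * c := by
      intro y hy
      have a1 := h1 y hy
      have a2 := h2 y hy
      have b1 : M * (p y - c) ≤ 3 * i := by nlinarith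
      have b2 : -(3 * i) ≤ M * (p y - c) := by nlinarith
      have b3 : (M * (p y - c)) ^ 2 ≤ (3 * (i : ℝ)) ^ 2 := sq_le_sq' b2 b1
      have : M * ((p y - c) ^ 2 * M) ≤ M * (9 * c) := by nlinarith
      exact le_of_mul_le_mul_left this hM
    calc (∑ y ∈ s, w y * (p y - c) ^ 2) * M ≤ ∑ y ∈ s, w y * (9 * c) := by
          rw [Finset.sum_mul]
          apply Finset.sum_le_sum
          intro y hy
          rw [mul_assoc]
          exact mul_le_mul_of_nonneg_left (key y hy) (hw y hy).le
      _ = 9 * S * c := by rw [← Finset.sum_mul, ← hS]; ring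

lemma cell_bound {X Y : Type} [Fintype X] [DecidableEq X] (s : Finset Y) (w : Y → ℝ)
    (P : X → Y → ℝ)
    (hw : ∀ y ∈ s, 0 < w y) (hP : ∀ x, ∀ y ∈ s, 0 ≤ P x y) (hP1 : ∀ y ∈ s, ∑ x, P x y = 1)
    (S : ℝ) (C : X → ℝ) (hS : S = ∑ y ∈ s, w y) (hSpos : 0 < S)
    (hC : ∀ x, S * C x = ∑ y ∈ s, w y * P x y) (M : ℝ) (hM : 0 < M) (i : X → ℕ) (x0 : X)
    (h0 : ∀ y ∈ s, 1 ≤ (Fintype.card X : ℝ) * P x0 y)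
    (h1 : ∀ x, x ≠ x0 → ∀ y ∈ s, (i x : ℝ) ^ 2 ≤ M * P x y)
    (h2 : ∀ x, x ≠ x0 → ∀ y ∈ s, M * P x y ≤ ((i x : ℝ) + 1) ^ 2) :
    ∑ x, (S * eta (C x) - ∑ y ∈ s, w y * eta (P x y)) ≤
      S * (9 * ((Fintype.card X : ℝ) - 1) * ((Fintype.card X : ℝ) + 1) / M) := by
  set n : ℝ := (Fintype.card X : ℝ) with hn
  have hcardpos : 1 ≤ Fintype.card X := Fintype.card_pos_iff.2 ⟨x0⟩
  have hn1 : 1 ≤ n := by rw [hn]; exact_mod_cast hcardpos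
  have hC0 : ∀ x, 0 ≤ C x := by
    intro x
    have : 0 ≤ S * C x :=
      (hC x) ▸ Finset.sum_nonneg (fun y hy => mul_nonneg (hw y hy).le (hP x y hy))
    exact nonneg_of_mul_nonneg_right this hSpos
  have hC1 : ∑ x, C x = 1 := by
    have : S * ∑ x, C x = S * 1 := by
      rw [Finset.mul_sum, Finset.sum_congr rfl (fun x _ => hC x), Finset.sum_comm, mul_one, hS]
      apply Finset.sum_congr rfl
      intro y hy
      rw [← Finset.mul_sum, hP1 y hy, mul_one]
    exact mul_left_cancel₀ hSpos.ne' this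
  have hCx0 : 1 ≤ n * C x0 := by
    have : S * 1 ≤ S * (n * C x0) := by
      rw [show S * (n * C x0) = n * (S * C x0) by ring, hC, hS, Finset.sum_mul, Finset.mul_sum]
      apply Finset.sum_le_sum
      intro y hy
      nlinarith [hw y hy, h0 y hy]
    exact le_of_mul_le_mul_left this hSpos
  have hCx0pos : 0 < C x0 := by
    rcases (hC0 x0).eq_or_lt with h | h
    · rw [← h] at hCx0; norm_num at hCx0
    · exact h
  set T : Finset X := Finset.univ.erase x0 with hT
  have hTcard : (T.card : ℝ) = n - 1 := by
    rw [hT, Finset.card_erase_of_mem (Finset.mem_univ _), Finset.card_univ, hn]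
    push_cast [hcardpos]; ring
  have hsplit : ∀ f : X → ℝ, ∑ x, f x = ∑ x ∈ T, f x + f x0 := by
    intro f
    rw [hT, Finset.sum_erase_add _ _ (Finset.mem_univ _)]
  have hV : ∀ x ∈ T, ∑ y ∈ s, w y * (P x y - C x) ^ 2 ≤ 9 * S * C x / M := by
    intro x hx
    have hne : x ≠ x0 := Finset.ne_of_mem_erase hx
    exact var_bound s w (P x) hw (hP x) S (C x) hS hSpos (hC x) M hM (i x) (h1 x hne) (h2 x hne)
  have hV0 : ∑ y ∈ s, w y * (P x0 y - C x0) ^ 2 ≤ (n - 1) * (9 * S / M) := by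
    calc ∑ y ∈ s, w y * (P x0 y - C x0) ^ 2
        ≤ ∑ y ∈ s, w y * ((n - 1) * ∑ x ∈ T, (P x y - C x) ^ 2) := by
          apply Finset.sum_le_sum
          intro y hy
          apply mul_le_mul_of_nonneg_left _ (hw y hy).le
          have e : P x0 y - C x0 = -∑ x ∈ T, (P x y - C x) := by
            have a1 := hsplit (fun x => P x y)
            have a2 := hsplit C
            simp only [hP1 y hy] at a1
            rw [hC1] at a2
            rw [Finset.sum_sub_distrib]
            linarith
          rw [e, neg_sq, ← hTcard]
          exact sq_sum_le_card_mul_sum_sq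
      _ = (n - 1) * ∑ x ∈ T, ∑ y ∈ s, w y * (P x y - C x) ^ 2 := by
          rw [Finset.sum_comm, Finset.mul_sum]
          apply Finset.sum_congr rfl
          intro y _
          rw [← Finset.mul_sum]; ring
      _ ≤ (n - 1) * ∑ x ∈ T, 9 * S * C x / M := by
          apply mul_le_mul_of_nonneg_left (Finset.sum_le_sum hV); linarith
      _ ≤ (n - 1) * (9 * S / M) := by
          apply mul_le_mul_of_nonneg_left _ (by linarith)
          have a2 := hsplit C
          rw [hC1] at a2
          have : ∑ x ∈ T, 9 * S * C x / M = (9 * S / M) * ∑ x ∈ T, C x := by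
            rw [Finset.mul_sum]
            apply Finset.sum_congr rfl
            intro y _
            ring
          rw [this]
          have : 0 ≤ 9 * S / M := by positivity
          apply mul_le_of_le_one_right this
          linarith
  have hJ := fun x => jensen_gap s w (P x) hw (hP x) S (C x) hS (hC0 x) (hC x)
  rw [hsplit]
  have hA : ∑ x ∈ T, (S * eta (C x) - ∑ y ∈ s, w y * eta (P x y)) ≤ (n - 1) * (9 * S / M) := by
    rw [← hTcard, ← nsmul_eq_mul]
    apply Finset.sum_le_card_nsmul
    intro x hx
    refine (hJ x).trans ?_
    apply div_le_of_le_mul₀ (hC0 x) (by positivity)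
    refine (hV x hx).trans (le_of_eq ?_)
    ring
  have hB : S * eta (C x0) - ∑ y ∈ s, w y * eta (P x0 y) ≤ n * ((n - 1) * (9 * S / M)) := by
    refine (hJ x0).trans ?_
    rw [div_le_iff₀ hCx0pos]
    refine hV0.trans ?_
    have : 0 ≤ (n - 1) * (9 * S / M) := mul_nonneg (by linarith) (by positivity)
    nlinarith
  refine (add_le_add hA hB).trans (le_of_eq ?_)
  ring

lemma quant_exists (m : ℕ) (hm : 0 < m) (p : ℝ) (hp : 0 ≤ p) (hp1 : p ≤ 1) :
    ∃ i : Fin m, ((i : ℕ) : ℝ) ^ 2 ≤ (m : ℝ) ^ 2 * p ∧ (m : ℝ) ^ 2 * p ≤ (((i : ℕ) : ℝ) + 1) ^ 2 := by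
  have hs0 := Real.sqrt_nonneg p
  have hs1 : √p ≤ 1 := Real.sqrt_le_one.2 hp1
  have hsq : √p ^ 2 = p := Real.sq_sqrt hp
  have hmr : (1 : ℝ) ≤ m := by exact_mod_cast hm
  have e : (m : ℝ) ^ 2 * p = (m * √p) ^ 2 := by rw [mul_pow, hsq]
  have hnn : 0 ≤ (m : ℝ) * √p := by positivity
  rw [e]
  by_cases h : ⌊(m : ℝ) * √p⌋₊ < m
  · refine ⟨⟨_, h⟩, ?_, ?_⟩
    · exact pow_le_pow_left₀ (by positivity) (Nat.floor_le hnn) 2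
    · exact pow_le_pow_left₀ hnn (Nat.lt_floor_add_one _).le 2
  · refine ⟨⟨m - 1, by omega⟩, ?_, ?_⟩
    · apply pow_le_pow_left₀ (by positivity)
      have : (m : ℝ) ≤ m * √p := (Nat.le_floor_iff hnn).1 (not_lt.1 h)
      push_cast [hm]
      linarith
    · apply pow_le_pow_left₀ hnn
      push_cast [hm]
      nlinarith

lemma quant_loss {X Y : Type} [Fintype X] [Fintype Y]
    (pX : X → ℝ) (W : X → Y → ℝ)
    (hW0 : ∀ x y, 0 ≤ W x y) (hW1 : ∀ x, ∑ y, W x y = 1)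
    (hpX : ∀ x, 0 < pX x) (hpXsum : ∑ x, pX x = 1)
    (hpY : ∀ y, 0 < outDist pX W y) (m : ℕ) (hm : 0 < m) :
    ∃ (Z : Type) (iZ : Fintype Z) (Q : X → Z → ℝ),
      Fintype.card Z = Fintype.card X * m ^ (Fintype.card X - 1) ∧ IsDegraded W Q ∧
      mutInfo pX W - mutInfo pX Q ≤
        9 * ((Fintype.card X : ℝ) - 1) * ((Fintype.card X : ℝ) + 1) / (m : ℝ) ^ 2 := by
  classical
  have hne : Nonempty X := by
    by_contra h
    rw [not_nonempty_iff] at h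
    simp at hpXsum
  have hP0 : ∀ x y, 0 ≤ post pX W x y := fun x y =>
    div_nonneg (mul_nonneg (hpX x).le (hW0 x y)) (hpY y).le
  have hP1 : ∀ y, ∑ x, post pX W x y = 1 := by
    intro y
    simp only [post]
    rw [← Finset.sum_div]
    exact div_self (hpY y).ne'
  have hPle : ∀ x y, post pX W x y ≤ 1 := fun x y => by
    rw [← hP1 y]
    exact Finset.single_le_sum (f := fun x => post pX W x y) (fun x _ => hP0 x y)
      (Finset.mem_univ x)
  have hmax : ∀ y, ∃ x0, 1 ≤ (Fintype.card X : ℝ) * post pX W x0 y := by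
    intro y
    obtain ⟨x0, hx0⟩ := Finite.exists_max (fun x => post pX W x y)
    refine ⟨x0, ?_⟩
    rw [← hP1 y, ← nsmul_eq_mul]
    exact Finset.sum_le_card_nsmul _ _ _ (fun x _ => hx0 x)
  choose top htop using hmax
  choose q hq1 hq2 using fun x y => quant_exists m hm (post pX W x y) (hP0 x y) (hPle x y)
  let Z := Σ x0 : X, ({x : X // x ≠ x0} → Fin m)
  let f : Y → Z := fun y => ⟨top y, fun x => q x y⟩
  let Q : X → Z → ℝ := fun x z => ∑ y, W x y * (if f y = z then 1 else 0)
  have hQ : ∀ x z, Q x z = ∑ y ∈ Finset.univ.filter (fun y => f y = z), W x y := by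
    intro x z
    simp [Q, Finset.sum_filter]
  refine ⟨Z, inferInstance, Q, ?_, ⟨fun y z => if f y = z then 1 else 0, ?_, ?_, ?_⟩, ?_⟩
  · simp [Z, Fintype.card_sigma]
  · intro y z
    dsimp only
    split_ifs <;> norm_num
  · intro y
    rw [Finset.sum_eq_single (f y)]
    · simp
    · intro b _ hb
      exact if_neg hb.symm
    · intro h
      exact absurd (Finset.mem_univ _) h
  · intro x z
    rfl
  · have hout : ∀ z, outDist pX Q z = ∑ y ∈ Finset.univ.filter (fun y => f y = z), outDist pX W y := by
      intro z
      simp only [outDist, hQ, Finset.mul_sum]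
      rw [Finset.sum_comm]
    have hsum1 : ∑ z, outDist pX Q z = 1 := by
      simp only [hout]
      rw [Finset.sum_fiberwise]
      simp only [outDist]
      rw [Finset.sum_comm, ← hpXsum]
      apply Finset.sum_congr rfl
      intro x _
      rw [← Finset.mul_sum, hW1, mul_one]
    set B : ℝ := 9 * ((Fintype.card X : ℝ) - 1) * ((Fintype.card X : ℝ) + 1) / (m : ℝ) ^ 2 with hB
    have hdec : mutInfo pX W - mutInfo pX Q = ∑ z, ∑ x, (outDist pX Q z * eta (post pX Q x z) -
        ∑ y ∈ Finset.univ.filter (fun y => f y = z), outDist pX W y * eta (post pX W x y)) := by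
      simp only [mutInfo, Finset.sum_sub_distrib]
      rw [Finset.sum_comm (γ := Z)]
      have : ∑ z : Z, ∑ x, ∑ y ∈ Finset.univ.filter (fun y => f y = z),
          outDist pX W y * eta (post pX W x y)
          = ∑ x, ∑ y, outDist pX W y * eta (post pX W x y) := by
        rw [Finset.sum_comm]
        apply Finset.sum_congr rfl
        intro x _
        rw [Finset.sum_fiberwise]
      rw [this]
      ring
    rw [hdec]
    calc _ ≤ ∑ z, outDist pX Q z * B := by
          apply Finset.sum_le_sum
          intro z _
          rcases (Finset.univ.filter (fun y => f y = z)).eq_empty_or_nonempty with hem | hnem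
          · have : outDist pX Q z = 0 := by rw [hout, hem]; simp
            rw [this, hem]; simp
          · have hSpos : 0 < outDist pX Q z := by
              rw [hout]
              exact Finset.sum_pos (fun y _ => hpY y) hnem
            obtain ⟨y0, hy0⟩ := hnem
            rw [Finset.mem_filter] at hy0
            have hfy : ∀ y, y ∈ Finset.univ.filter (fun y => f y = z) →
                top y = top y0 ∧ ∀ x, x ≠ top y0 → q x y = q x y0 := by
              intro y hy
              rw [Finset.mem_filter] at hy
              have h : f y = f y0 := hy.2.trans hy0.2.symm
              simp only [f] at h
              have ht : top y = top y0 := congrArg Sigma.fst h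
              refine ⟨ht, fun x hx => ?_⟩
              have key : ∀ z : Z, ∀ z' : Z, z = z' → ∀ (h1 : x ≠ z.1) (h2 : x ≠ z'.1),
                  z.2 ⟨x, h1⟩ = z'.2 ⟨x, h2⟩ := by
                rintro z z' rfl h1 h2; rfl
              exact key _ _ h (by simpa [ht] using hx) hx
            apply cell_bound (Finset.univ.filter (fun y => f y = z)) (outDist pX W) (post pX W)
              (fun y _ => hpY y) (fun x y _ => hP0 x y) (fun y _ => hP1 y) _ _ (hout z) hSpos
              _ _ (by positivity) (fun x => (q x y0 : ℕ)) (top y0)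
            · intro y hy
              rw [← (hfy y hy).1]; exact htop y
            · intro x hx y hy
              rw [← (hfy y hy).2 x hx]; exact hq1 x y
            · intro x hx y hy
              rw [← (hfy y hy).2 x hx]; exact hq2 x y
            · intro x
              simp only [post]
              rw [mul_div_cancel₀ _ hSpos.ne', hQ, Finset.mul_sum]
              apply Finset.sum_congr rfl
              intro y _
              rw [mul_div_cancel₀ _ (hpY y).ne']
      _ = B := by rw [← Finset.sum_mul, hsum1, one_mul]

lemma gamma_bound : ∀ d : ℕ, Real.Gamma (1 + (d : ℝ) / 2) ≤ (d : ℝ) ^ ((d : ℝ) / 2)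
  | 0 => by simp
  | 1 => by
    have h : Real.Gamma (1 + 1 / 2) = 1 / 2 * √Real.pi := by
      rw [add_comm, Real.Gamma_add_one (by norm_num), Real.Gamma_one_half_eq]
    have : √Real.pi ≤ 2 := by
      rw [Real.sqrt_le_left (by norm_num)]
      linarith [Real.pi_le_four]
    simp only [Nat.cast_one, Real.one_rpow]
    rw [h]; linarith
  | d + 2 => by
    have ih := gamma_bound d
    have e : (1 : ℝ) + ((d + 2 : ℕ) : ℝ) / 2 = (1 + (d : ℝ) / 2) + 1 := by push_cast; ring
    have hd : (0 : ℝ) ≤ d := Nat.cast_nonneg d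
    rw [e, Real.Gamma_add_one (by positivity)]
    have e2 : ((d + 2 : ℕ) : ℝ) / 2 = (d : ℝ) / 2 + 1 := by push_cast; ring
    rw [e2, Real.rpow_add_one (by positivity), mul_comm]
    push_cast
    apply mul_le_mul _ (by linarith) (by positivity) (by positivity)
    exact ih.trans (Real.rpow_le_rpow hd (by linarith) (by positivity))

lemma const_bound (d L m : ℕ) (hd : 1 ≤ d) (hL : 2 * (d + 1) ≤ L) 
    (hm : ((L : ℝ) / (d + 1)) ^ (1 / (d : ℝ)) ≤ 2 * m) (hm1 : 1 ≤ m) :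
    9 * (d : ℝ) * ((d : ℝ) + 1 + 1) / (m : ℝ) ^ 2 ≤
      ((d : ℝ) / 2 *
          (Real.pi * ((d : ℝ) + 1) /
              (Real.sqrt (1 + 1 / (2 * (d : ℝ))) - 1) ^ 2 *
            (2 * ((d : ℝ) + 1) /
                Real.Gamma (1 + (d : ℝ) / 2)) ^
              (2 / (d : ℝ)))) *
        (L : ℝ) ^ (-(2 / (d : ℝ))) := by
  have hdr : (1 : ℝ) ≤ d := by exact_mod_cast hd
  have hd0 : (0 : ℝ) < d := by linarith
  have hL0 : (0 : ℝ) < L := by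
    have : 0 < L := by omega
    exact_mod_cast this
  have hmr : (1 : ℝ) ≤ m := by exact_mod_cast hm1
  set n : ℝ := (d : ℝ) + 1 with hn
  set A : ℝ := (L / n) ^ (2 / (d : ℝ)) with hA
  have hApos : 0 < A := by positivity
  have hA4 : A ≤ 4 * (m : ℝ) ^ 2 := by
    have : A = ((L / n) ^ (1 / (d : ℝ))) ^ 2 := by
      rw [hA, ← Real.rpow_natCast, ← Real.rpow_mul (by positivity)]
      congr 1
      push_cast; ring
    rw [this]
    calc _ ≤ (2 * (m : ℝ)) ^ 2 := pow_le_pow_left₀ (by positivity) hm 2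
      _ = _ := by ring
  -- square root factor
  have hs : 16 * (d : ℝ) ^ 2 ≤ 1 / (Real.sqrt (1 + 1 / (2 * (d : ℝ))) - 1) ^ 2 := by
    have h1 : 1 < √(1 + 1 / (2 * (d : ℝ))) := by
      rw [Real.lt_sqrt (by norm_num)]
      have : 0 < 1 / (2 * (d : ℝ)) := by positivity
      linarith
    have h2 : √(1 + 1 / (2 * (d : ℝ))) ≤ 1 + 1 / (4 * d) := by
      rw [Real.sqrt_le_left (by positivity)]
      have : (1 + 1 / (4 * (d : ℝ))) ^ 2 = 1 + 1 / (2 * (d : ℝ)) + (1 / (4 * d)) ^ 2 := by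
        field_simp; ring
      rw [this]
      nlinarith [sq_nonneg (1 / (4 * (d : ℝ)))]
    rw [le_div_iff₀ (by have : 0 < √(1 + 1 / (2 * (d : ℝ))) - 1 := by linarith
                        positivity)]
    have h3 : (√(1 + 1 / (2 * (d : ℝ))) - 1) ^ 2 ≤ (1 / (4 * d)) ^ 2 :=
      pow_le_pow_left₀ (by linarith) (by linarith) 2
    calc _ ≤ 16 * (d : ℝ) ^ 2 * (1 / (4 * d)) ^ 2 := by gcongr
      _ = 1 := by field_simp; norm_num
  -- gamma factor
  have hΓpos : 0 < Real.Gamma (1 + (d : ℝ) / 2) := Real.Gamma_pos_of_pos (by positivity)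
  have hg : (2 : ℝ) ^ (2 / (d : ℝ)) / d * n ^ (2 / (d : ℝ)) ≤
      (2 * n / Real.Gamma (1 + (d : ℝ) / 2)) ^ (2 / (d : ℝ)) := by
    rw [Real.div_rpow (by positivity) hΓpos.le, Real.mul_rpow (by norm_num) (by positivity)]
    have : Real.Gamma (1 + (d : ℝ) / 2) ^ (2 / (d : ℝ)) ≤ d := by
      calc _ ≤ ((d : ℝ) ^ ((d : ℝ) / 2)) ^ (2 / (d : ℝ)) :=
            Real.rpow_le_rpow hΓpos.le (gamma_bound d) (by positivity)
        _ = d := by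
          rw [← Real.rpow_mul hd0.le]
          have : (d : ℝ) / 2 * (2 / d) = 1 := by field_simp
          rw [this, Real.rpow_one]
    rw [div_mul_eq_mul_div]
    gcongr
  have hLA : n ^ (2 / (d : ℝ)) * (L : ℝ) ^ (-(2 / (d : ℝ))) = 1 / A := by
    rw [hA, Real.div_rpow hL0.le (by positivity), Real.rpow_neg hL0.le, one_div_div]
    rfl
  have hnum : 36 * (d : ℝ) * (n + 1) ≤
      (d : ℝ) / 2 * (3 * n * (16 * (d : ℝ) ^ 2) * ((2 : ℝ) ^ (2 / (d : ℝ)) / d)) := by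
    have e : (d : ℝ) / 2 * (3 * n * (16 * (d : ℝ) ^ 2) * ((2 : ℝ) ^ (2 / (d : ℝ)) / d))
        = d * (24 * n * d * (2 : ℝ) ^ (2 / (d : ℝ))) := by
      field_simp; ring
    rw [e, show 36 * (d : ℝ) * (n + 1) = d * (36 * (n + 1)) by ring]
    apply mul_le_mul_of_nonneg_left _ hd0.le
    rcases hd.eq_or_lt with h | h
    · subst h
      norm_num [hn]
    · have h2 : (2 : ℝ) ≤ d := by exact_mod_cast h
      have h1 : (1 : ℝ) ≤ 2 ^ (2 / (d : ℝ)) :=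
        Real.one_le_rpow (by norm_num) (by positivity)
      have : 24 * n * d * 1 ≤ 24 * n * d * (2 : ℝ) ^ (2 / (d : ℝ)) := by gcongr
      nlinarith
  calc 9 * (d : ℝ) * (n + 1) / (m : ℝ) ^ 2 ≤ 36 * (d : ℝ) * (n + 1) / A := by
        rw [div_le_div_iff₀ (by positivity) hApos]
        have : 0 ≤ 9 * (d : ℝ) * (n + 1) := by positivity
        nlinarith
    _ ≤ (d : ℝ) / 2 * (3 * n * (16 * (d : ℝ) ^ 2) * ((2 : ℝ) ^ (2 / (d : ℝ)) / d)) / A := by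
        gcongr
    _ = (d : ℝ) / 2 * (3 * n * (16 * (d : ℝ) ^ 2) *
          ((2 : ℝ) ^ (2 / (d : ℝ)) / d * n ^ (2 / (d : ℝ)))) * (L : ℝ) ^ (-(2 / (d : ℝ))) := by
        rw [div_eq_mul_one_div, ← hLA]; ring
    _ ≤ (d : ℝ) / 2 * (Real.pi * n * (1 / (Real.sqrt (1 + 1 / (2 * (d : ℝ))) - 1) ^ 2) *
          (2 * n / Real.Gamma (1 + (d : ℝ) / 2)) ^ (2 / (d : ℝ))) *
          (L : ℝ) ^ (-(2 / (d : ℝ))) := by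
        have := Real.pi_gt_three.le
        gcongr
    _ = _ := by rw [mul_one_div]

/-- **Main result.** If `|Y| > 2|X|` and `L ≥ 2|X|`, then the optimal degrading loss satisfies
`ΔI* ≤ ν(|X|) ⬝ L ^ (-2/(|X|-1))`: there exists a channel `Q` with at most `L` output letters,
degraded with respect to `W`, with `I(W,P_X) - I(Q,P_X)` at most this bound. -/
theorem optimal_degrading_loss_le {X Y : Type} [Fintype X] [Fintype Y]
    (pX : X → ℝ) (W : X → Y → ℝ)
    (hW0 : ∀ x y, 0 ≤ W x y) (hW1 : ∀ x, ∑ y, W x y = 1)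
    (hpX : ∀ x, 0 < pX x) (hpXsum : ∑ x, pX x = 1)
    (hpY : ∀ y, 0 < outDist pX W y)
    (hcard : 2 * Fintype.card X < Fintype.card Y)
    (L : ℕ) (hL : 2 * Fintype.card X ≤ L) :
    ∃ (Z : Type) (iZ : Fintype Z) (Q : X → Z → ℝ),
      Fintype.card Z ≤ L ∧ IsDegraded W Q ∧
      mutInfo pX W - mutInfo pX Q ≤
        (((Fintype.card X : ℝ) - 1) / 2 *
          (Real.pi * (Fintype.card X : ℝ) /
              (Real.sqrt (1 + 1 / (2 * ((Fintype.card X : ℝ) - 1))) - 1) ^ 2 *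
            (2 * (Fintype.card X : ℝ) /
                Real.Gamma (1 + ((Fintype.card X : ℝ) - 1) / 2)) ^
              (2 / ((Fintype.card X : ℝ) - 1)))) *
        (L : ℝ) ^ (-(2 / ((Fintype.card X : ℝ) - 1))) := by
  classical
  have hne : 1 ≤ Fintype.card X := by
    rcases Nat.eq_zero_or_pos (Fintype.card X) with h | h
    · rw [Fintype.card_eq_zero_iff] at h
      simp at hpXsum
    · exact h
  obtain ⟨d, hd⟩ : ∃ d, Fintype.card X = d + 1 := ⟨Fintype.card X - 1, by omega⟩
  have hcast : (Fintype.card X : ℝ) = (d : ℝ) + 1 := by rw [hd]; push_cast; ring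
  have hcast' : (Fintype.card X : ℝ) - 1 = d := by rw [hcast]; ring
  rcases Nat.eq_zero_or_pos d with h0 | hdpos
  · obtain ⟨Z, iZ, Q, h1, h2, h3⟩ := quant_loss pX W hW0 hW1 hpX hpXsum hpY 1 one_pos
    refine ⟨Z, iZ, Q, ?_, h2, h3.trans ?_⟩
    · rw [h1]; simp; omega
    · rw [hcast', h0]; simp
  · have hdr : (1 : ℝ) ≤ d := by exact_mod_cast hdpos
    have hLr : 2 * ((d : ℝ) + 1) ≤ L := by rw [hd] at hL; exact_mod_cast hL
    have hr1 : 1 ≤ (L : ℝ) / (d + 1) := by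
      rw [le_div_iff₀ (by positivity)]; linarith
    set r : ℝ := ((L : ℝ) / (d + 1)) ^ (1 / (d : ℝ)) with hr
    have hr1' : 1 ≤ r := Real.one_le_rpow hr1 (by positivity)
    have hm1 : 1 ≤ ⌊r⌋₊ := by rw [Nat.one_le_floor_iff]; exact hr1'
    have hm2 : r ≤ 2 * (⌊r⌋₊ : ℝ) := by
      have a1 := Nat.lt_floor_add_one r
      have a2 : (1 : ℝ) ≤ ⌊r⌋₊ := by exact_mod_cast hm1
      linarith
    have hm3 : ((d : ℝ) + 1) * (⌊r⌋₊ : ℝ) ^ d ≤ L := by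
      have a1 : (⌊r⌋₊ : ℝ) ^ d ≤ r ^ d :=
        pow_le_pow_left₀ (by positivity) (Nat.floor_le (by linarith)) d
      have a2 : r ^ d = (L : ℝ) / (d + 1) := by
        rw [hr, one_div, Real.rpow_inv_natCast_pow (by positivity) (by omega)]
      rw [a2, le_div_iff₀ (by positivity)] at a1
      linarith
    obtain ⟨Z, iZ, Q, h1, h2, h3⟩ :=
      quant_loss pX W hW0 hW1 hpX hpXsum hpY ⌊r⌋₊ (by omega)
    refine ⟨Z, iZ, Q, ?_, h2, h3.trans ?_⟩
    · rw [h1, hd]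
      simp only [Nat.add_sub_cancel]
      exact_mod_cast hm3
    · rw [hcast', hcast]
      exact const_bound d L ⌊r⌋₊ hdpos (by omega) hm2 hm1
end
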